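/- arXiv:1704.04439 — 2 statements merged into one kernel-verified Lean document; each statement's English description precedes it below -/
import Mathlib

section
/- Let λ be a partition and let θ = (θ_i)_{i≥1} be a sequence of positive real numbers which is bounded with sup_i θ_i < 1 (equivalently, there exists b < 1 with 0 < θ_i ≤ b for all i). Then the sequence r ↦ S_λ^{(r)}(θ) (indexed by integers r ≥ 1) converges to a finite limit as r → ∞. -/
/-- A filling of the Young diagram `μ` with entries in `Fin r` (the value `v : Fin r`
representing the letter `v + 1` of the alphabet `{1, …, r}`) is semistandard if its rows
weakly increase from left to right and its columns strictly increase downwards.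
Cells are pairs `(i, j)` with `i` the (0-indexed) row and `j` the (0-indexed) column. -/
def IsSSYT {μ : YoungDiagram} {r : ℕ} (T : ↥μ.cells → Fin r) : Prop :=
  (∀ c c' : ↥μ.cells, (c : ℕ × ℕ).1 = (c' : ℕ × ℕ).1 → (c : ℕ × ℕ).2 ≤ (c' : ℕ × ℕ).2 →
    T c ≤ T c') ∧
  (∀ c c' : ↥μ.cells, (c : ℕ × ℕ).2 = (c' : ℕ × ℕ).2 → (c : ℕ × ℕ).1 < (c' : ℕ × ℕ).1 →
    T c < T c')

instance {μ : YoungDiagram} {r : ℕ} : DecidablePred (IsSSYT (μ := μ) (r := r)) :=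
  fun T => by unfold IsSSYT; infer_instance

/-- The normalized Weyl character `S_λ^{(r)}(θ) = S_λ^{gl_r}(θ_{[r]})`, for a partition
`λ` encoded as the Young diagram `μ` (so `λ_{i+1} = μ.rowLen i`) and a sequence
`θ : ℕ → ℝ` of parameters (with `θ j` representing `θ_{j+1}`):
`S_λ^{(r)}(θ) = Σ_T ∏_{i=1}^{r−1} θ_i^{c_i(T)}`, the sum being over all SSYT `T` of
shape `λ` with entries in `{1,…,r}`, where
`c_i(T) = (λ_1 + ⋯ + λ_i) − #{boxes of T with entry ≤ i}` (a nonnegative integer;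
here a cell `c` has entry `(T c : ℕ) + 1`). -/
noncomputable def normalizedChar (μ : YoungDiagram) (r : ℕ) (θ : ℕ → ℝ) : ℝ :=
  ∑ T ∈ Finset.univ.filter (fun T : ↥μ.cells → Fin r => IsSSYT T),
    ∏ j ∈ Finset.range (r - 1),
      θ j ^ ((∑ k ∈ Finset.range (j + 1), μ.rowLen k) -
        (Finset.univ.filter (fun c : ↥μ.cells => (T c : ℕ) ≤ j)).card)

open Filter

/-- In a semistandard filling every entry is at least the index of its row. -/
theorem IsSSYT.row_le {μ : YoungDiagram} {r : ℕ} {T : ↥μ.cells → Fin r} (hT : IsSSYT T)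
    (c : ↥μ.cells) : (c : ℕ × ℕ).1 ≤ (T c : ℕ) := by
  obtain ⟨⟨i, j⟩, hc⟩ := c
  induction i with
  | zero => exact Nat.zero_le _
  | succ i ih =>
    have hc' : (i, j) ∈ μ.cells :=
      μ.up_left_mem (Nat.le_succ i) le_rfl hc
    have hlt := hT.2 ⟨(i, j), hc'⟩ ⟨(i + 1, j), hc⟩ rfl (Nat.lt_succ_self i)
    exact lt_of_le_of_lt (ih hc') hlt

/-- The first `j + 1` row lengths add up to the number of cells in rows `0, …, j`. -/
theorem YoungDiagram.sum_rowLen_eq_card (μ : YoungDiagram) (j : ℕ) :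
    ∑ k ∈ Finset.range (j + 1), μ.rowLen k =
      (Finset.univ.filter (fun c : ↥μ.cells => (c : ℕ × ℕ).1 ≤ j)).card := by
  have h : (Finset.univ.filter (fun c : ↥μ.cells => (c : ℕ × ℕ).1 ≤ j)).card =
      (μ.cells.filter (fun c => c.1 ≤ j)).card := by
    rw [← Finset.card_map (Function.Embedding.subtype _)]
    congr 1
    ext x
    simp [and_comm]
  rw [h, Finset.card_eq_sum_card_fiberwise (f := Prod.fst) (t := Finset.range (j + 1))
    (fun x hx => by simp at hx ⊢; omega)]
  refine Finset.sum_congr rfl fun k hk => ?_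
  rw [YoungDiagram.rowLen_eq_card, YoungDiagram.row, Finset.filter_filter]
  congr 1
  refine Finset.filter_congr fun x _ => ?_
  rw [Finset.mem_range] at hk
  omega

/-- The weight of a semistandard filling factors over the cells. -/
theorem IsSSYT.prod_pow_eq {μ : YoungDiagram} {r : ℕ} {T : ↥μ.cells → Fin r} (hT : IsSSYT T)
    (θ : ℕ → ℝ) :
    ∏ j ∈ Finset.range (r - 1),
      θ j ^ ((∑ k ∈ Finset.range (j + 1), μ.rowLen k) -
        (Finset.univ.filter (fun c : ↥μ.cells => (T c : ℕ) ≤ j)).card) =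
      ∏ c : ↥μ.cells, ∏ j ∈ Finset.Ico (c : ℕ × ℕ).1 (T c : ℕ), θ j := by
  have h1 : ∀ j, θ j ^ ((∑ k ∈ Finset.range (j + 1), μ.rowLen k) -
        (Finset.univ.filter (fun c : ↥μ.cells => (T c : ℕ) ≤ j)).card) =
      ∏ c : ↥μ.cells, if (c : ℕ × ℕ).1 ≤ j ∧ j < (T c : ℕ) then θ j else 1 := by
    intro j
    rw [← Finset.prod_filter, Finset.prod_const, μ.sum_rowLen_eq_card,
      ← Finset.card_sdiff_of_subset]
    · congr 2
      ext c
      simp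
    · intro c
      simpa using (hT.row_le c).trans
  simp_rw [h1]
  rw [Finset.prod_comm]
  refine Finset.prod_congr rfl fun c _ => ?_
  rw [← Finset.prod_filter]
  refine Finset.prod_congr ?_ fun _ _ => rfl
  ext j
  have := (T c).isLt
  simp only [Finset.mem_filter, Finset.mem_range, Finset.mem_Ico]
  omega

theorem normalizedChar_eq_sum_prod (μ : YoungDiagram) (r : ℕ) (θ : ℕ → ℝ) :
    normalizedChar μ r θ =
      ∑ T ∈ Finset.univ.filter (fun T : ↥μ.cells → Fin r => IsSSYT T),
        ∏ c : ↥μ.cells, ∏ j ∈ Finset.Ico (c : ℕ × ℕ).1 (T c : ℕ), θ j :=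
  Finset.sum_congr rfl fun _ hT => (Finset.mem_filter.1 hT).2.prod_pow_eq θ

theorem normalizedChar_monotone (μ : YoungDiagram) {θ : ℕ → ℝ} (hθ : ∀ i, 0 ≤ θ i) :
    Monotone fun r : ℕ => normalizedChar μ r θ := by
  intro r s hrs
  simp only [normalizedChar_eq_sum_prod]
  let f : (↥μ.cells → Fin r) → (↥μ.cells → Fin s) := fun T c => Fin.castLE hrs (T c)
  have hf : Function.Injective f := fun T T' h =>
    funext fun c => Fin.castLE_injective hrs (congrFun h c)
  calc _ = ∑ T ∈ (Finset.univ.filter (fun T : ↥μ.cells → Fin r => IsSSYT T)).image f,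
        ∏ c : ↥μ.cells, ∏ j ∈ Finset.Ico (c : ℕ × ℕ).1 (T c : ℕ), θ j := by
        rw [Finset.sum_image hf.injOn]
        rfl
    _ ≤ _ := by
        refine Finset.sum_le_sum_of_subset_of_nonneg ?_ fun T _ _ =>
          Finset.prod_nonneg fun c _ => Finset.prod_nonneg fun j _ => hθ j
        intro T' hT'
        obtain ⟨T, hT, rfl⟩ := Finset.mem_image.1 hT'
        have hT := (Finset.mem_filter.1 hT).2
        exact Finset.mem_filter.2 ⟨Finset.mem_univ _, hT⟩

theorem normalizedChar_le (μ : YoungDiagram) (r : ℕ) {θ : ℕ → ℝ} (hθ : ∀ i, 0 ≤ θ i)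
    {b : ℝ} (hb : b < 1) (hub : ∀ i, θ i ≤ b) :
    normalizedChar μ r θ ≤ ∏ c : ↥μ.cells, ∑' t : ℕ, b ^ (t - (c : ℕ × ℕ).1) := by
  have hb0 : 0 ≤ b := (hθ 0).trans (hub 0)
  have hsum : ∀ i : ℕ, Summable fun t : ℕ => b ^ (t - i) := fun i => by
    rw [← summable_nat_add_iff i]
    simpa using summable_geometric_of_lt_one hb0 hb
  have hnonneg : ∀ i t : ℕ, 0 ≤ ∏ j ∈ Finset.Ico i t, θ j := fun i t =>
    Finset.prod_nonneg fun j _ => hθ j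
  rw [normalizedChar_eq_sum_prod]
  calc _ ≤ ∑ T : ↥μ.cells → Fin r,
        ∏ c : ↥μ.cells, ∏ j ∈ Finset.Ico (c : ℕ × ℕ).1 (T c : ℕ), θ j :=
        Finset.sum_le_sum_of_subset_of_nonneg (Finset.filter_subset _ _) fun T _ _ =>
          Finset.prod_nonneg fun c _ => hnonneg _ _
    _ = ∏ c : ↥μ.cells, ∑ t : Fin r, ∏ j ∈ Finset.Ico (c : ℕ × ℕ).1 (t : ℕ), θ j := by
        rw [Finset.prod_univ_sum, Fintype.piFinset_univ]
    _ ≤ _ := by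
        refine Finset.prod_le_prod (fun c _ => Finset.sum_nonneg fun t _ => hnonneg _ _)
          fun c _ => ?_
        rw [Fin.sum_univ_eq_sum_range (fun t => ∏ j ∈ Finset.Ico (c : ℕ × ℕ).1 t, θ j) r]
        refine le_trans (Finset.sum_le_sum fun t _ => ?_)
          ((hsum (c : ℕ × ℕ).1).sum_le_tsum (Finset.range r) fun t _ => pow_nonneg hb0 _)
        refine (Finset.prod_le_prod (fun j _ => hθ j) fun j _ => hub j).trans_eq ?_
        rw [Finset.prod_const, Nat.card_Ico]

/-- Theorem (n) of the paper: if `θ = (θ_i)_{i≥1}` is a sequence of positive reals which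
is bounded with `sup θ < 1` (equivalently, `0 < θ_i ≤ b` for all `i`, for some `b < 1`),
then for any partition `λ` the sequence `r ↦ S_λ^{(r)}(θ)` converges to a finite limit. -/
theorem normalizedChar_converges (μ : YoungDiagram) (θ : ℕ → ℝ) (hpos : ∀ i, 0 < θ i)
    (b : ℝ) (hb : b < 1) (hub : ∀ i, θ i ≤ b) :
    ∃ L : ℝ, Tendsto (fun r : ℕ => normalizedChar μ r θ) atTop (nhds L) := by
  have hθ : ∀ i, 0 ≤ θ i := fun i => (hpos i).le
  have hbdd : BddAbove (Set.range fun r : ℕ => normalizedChar μ r θ) := by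
    refine ⟨∏ c : ↥μ.cells, ∑' t : ℕ, b ^ (t - (c : ℕ × ℕ).1), ?_⟩
    rintro _ ⟨r, rfl⟩
    exact normalizedChar_le μ r hθ hb hub
  exact ⟨_, tendsto_atTop_ciSup (normalizedChar_monotone μ hθ) hbdd⟩
end

section
/- Let λ be a partition with ℓ = ℓ(λ) nonzero parts and let b be a real number with 0 < b < 1. Then the family (b^{e(T)}), indexed by all semistandard Young tableaux T of shape λ with entries in the positive integers {1,2,3,…} (no upper bound on the entries), is summable, and its sum equals b^{n(λ)} · ∏_{1 ≤ i < j ≤ ℓ} (1 − b^{λ_i − λ_j + j − i})/(1 − b^{j − i}) · ∏_{i=1}^{ℓ} ∏_{j=ℓ+1}^{∞} (1 − b^{λ_i + j − i})/(1 − b^{j − i}), where e(T) = Σ_{boxes c of T} (T(c) − 1) and the infinite products converge. -/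
/-- A filling of the Young diagram `μ` with entries in the positive integers (the value
`v : ℕ` of a cell representing the letter `v + 1` of the alphabet `{1, 2, 3, …}`) is
semistandard if its rows weakly increase from left to right and its columns strictly
increase downwards. Cells are pairs `(i, j)` with `i` the (0-indexed) row and `j` the
(0-indexed) column. -/
def IsSSYTNat (μ : YoungDiagram) (T : ↥μ.cells → ℕ) : Prop :=
  (∀ c c' : ↥μ.cells, (c : ℕ × ℕ).1 = (c' : ℕ × ℕ).1 → (c : ℕ × ℕ).2 ≤ (c' : ℕ × ℕ).2 →
    T c ≤ T c') ∧
  (∀ c c' : ↥μ.cells, (c : ℕ × ℕ).2 = (c' : ℕ × ℕ).2 → (c : ℕ × ℕ).1 < (c' : ℕ × ℕ).1 →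
    T c < T c')

open Finset in
theorem det_cons_pow_eq_sum {R : Type*} [CommRing R] {N : ℕ} (x : Fin N → R) (z : R)
    (a : Fin (N + 1) → ℕ) (ha : Monotone a) :
    (Matrix.of fun i j => (Fin.cons z x : Fin (N + 1) → R) j ^ a i).det =
      (∏ j, (x j - z)) * ∑ m ∈ Fintype.piFinset fun i : Fin N => Ico (a i.castSucc) (a i.succ),
        (z ^ a 0 * ∏ i : Fin N, z ^ (a i.succ - 1 - m i)) *
          (Matrix.of fun i j => x j ^ m i).det := by
  have hle (i : Fin N) : a i.castSucc ≤ a i.succ := ha i.castSucc_lt_succ.le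
  set A : Matrix (Fin (N + 1)) (Fin (N + 1)) R :=
    Matrix.of fun i j => (Fin.cons z x : Fin (N + 1) → R) j ^ a i
  let B : Matrix (Fin (N + 1)) (Fin (N + 1)) R := Matrix.of fun i j =>
    Fin.cases (motive := fun _ => R) (A 0 j)
      (fun i => A i.succ j - z ^ (a i.succ - a i.castSucc) * A i.castSucc j) i
  have hAB : B.det = A.det :=
    (Matrix.det_eq_of_forall_row_eq_smul_add_pred (A := A) (B := B)
      (fun i => z ^ (a i.succ - a i.castSucc)) (fun j => by simp [B]) fun i j => by simp [B]).symm
  have hB0 (i : Fin N) : B i.succ 0 = 0 := by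
    simp [B, A, ← pow_add, Nat.sub_add_cancel (hle i)]
  have hB00 : B 0 0 = z ^ a 0 := by simp [B, A]
  let C : Matrix (Fin N) (Fin N) R := Matrix.of fun i j =>
    ∑ m ∈ Ico (a i.castSucc) (a i.succ), x j ^ m * z ^ (a i.succ - 1 - m)
  have hB : B.submatrix Fin.succ Fin.succ = Matrix.of fun i j => (x j - z) * C i j := by
    ext i j
    simp [B, A, C, mul_comm (x j - z), (Commute.all (x j) z).geom_sum₂_Ico_mul (hle i)]
  have hC : C.det = ∑ m ∈ Fintype.piFinset fun i : Fin N => Ico (a i.castSucc) (a i.succ),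
      (∏ i : Fin N, z ^ (a i.succ - 1 - m i)) * (Matrix.of fun i j => x j ^ m i).det := by
    have h := (Matrix.detRowAlternating (n := Fin N) (R := R)).toMultilinearMap.map_sum_finset
      (fun (i : Fin N) (m : ℕ) (j : Fin N) => z ^ (a i.succ - 1 - m) * x j ^ m)
      (fun i => Ico (a i.castSucc) (a i.succ))
    refine Eq.trans (congrArg Matrix.det ?_) (h.trans (sum_congr rfl fun m _ => ?_))
    · ext i j
      simp [C, Finset.sum_apply, mul_comm]
    · exact Matrix.det_mul_column (fun i => z ^ (a i.succ - 1 - m i))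
        (Matrix.of fun i j => x j ^ m i)
  rw [← hAB, Matrix.det_succ_column_zero, Fin.sum_univ_succ]
  simp only [hB0, hB00, mul_zero, zero_mul, sum_const_zero, add_zero, Fin.succAbove_zero, hB,
    Matrix.det_mul_row, hC, Fin.val_zero, pow_zero, one_mul, mul_sum]
  exact sum_congr rfl fun m _ => by ring

/-- The alternant `det (x_j ^ (f_i + N - 1 - i))` in the variables `x_0, …, x_{N-1}`, with both
rows and columns listed in reverse order. -/
def alternant {R : Type*} [CommRing R] (N : ℕ) (x : ℕ → R) (f : ℕ → ℕ) : R :=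
  (Matrix.of fun i j : Fin N => x j.rev ^ (f i.rev + i)).det

/-- Extension by zero of a sequence of length `N`. -/
def extendZero {N : ℕ} (g : Fin N → ℕ) (i : ℕ) : ℕ :=
  if h : i < N then g ⟨i, h⟩ else 0

@[simp]
theorem extendZero_val {N : ℕ} (g : Fin N → ℕ) (i : Fin N) : extendZero g i = g i := by
  simp [extendZero]

open Finset in
theorem alternant_succ {R : Type*} [CommRing R] (N : ℕ) (x : ℕ → R) (f : ℕ → ℕ)
    (hf : Antitone f) :
    alternant (N + 1) x f = (∏ j ∈ range N, (x j - x N)) *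
      ∑ g ∈ Fintype.piFinset fun i : Fin N => Icc (f (i + 1)) (f i),
        (x N ^ f N * ∏ i : Fin N, x N ^ (f i - g i)) * alternant N x (extendZero g) := by
  have key := det_cons_pow_eq_sum (fun j : Fin N => x j.rev) (x N)
    (fun i : Fin (N + 1) => f i.rev + i)
    (fun i j hij => add_le_add (hf (Fin.rev_le_rev.2 hij)) hij)
  have hx : (Fin.cons (x N) (fun j : Fin N => x j.rev) : Fin (N + 1) → R) =
      fun j => x j.rev := by
    ext j
    cases j using Fin.cases with
    | zero => simp
    | succ j => simp [Fin.rev_succ]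
  rw [hx] at key
  refine key.trans ?_
  congr 1
  · rw [← Fin.prod_univ_eq_prod_range (fun j => x j - x N)]
    exact Equiv.prod_comp Fin.revPerm (fun j : Fin N => x j - x N)
  · refine (sum_nbij' (fun g (i : Fin N) => g i.rev + (i : ℕ))
      (fun m (i : Fin N) => m i.rev - (i.rev : ℕ)) ?_ ?_ ?_ ?_ ?_).symm
    · intro g hg
      simp only [Fintype.mem_piFinset, mem_Icc, mem_Ico] at hg ⊢
      intro i
      have := hg i.rev
      simp [Fin.rev_succ, Fin.rev_castSucc] at this ⊢
      omega
    · intro m hm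
      simp only [Fintype.mem_piFinset, mem_Icc, mem_Ico] at hm ⊢
      intro i
      have := hm i.rev
      simp [Fin.rev_succ, Fin.rev_castSucc] at this ⊢
      omega
    · intro g _
      ext i
      simp
    · intro m hm
      simp only [Fintype.mem_piFinset, mem_Ico] at hm
      ext i
      have := (hm i).1
      simp at this ⊢
      omega
    · intro g hg
      simp only [Fintype.mem_piFinset, mem_Icc] at hg
      congr 1
      · congr 1
        rw [← Equiv.prod_comp Fin.revPerm]
        refine prod_congr rfl fun i _ => ?_
        congr 1
        have := hg i.rev
        simp [Fin.rev_succ] at this ⊢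
        omega
      · simp only [alternant, extendZero_val]

/-- A filling `T` of the rows `{(i, j) | j < f i}`, extended by zero, is a semistandard tableau
with entries smaller than `N`. -/
structure IsBoundedSSYT (N : ℕ) (f : ℕ → ℕ) (T : ℕ → ℕ → ℕ) : Prop where
  eq_zero : ∀ i j, f i ≤ j → T i j = 0
  row_weak : ∀ i j k, j ≤ k → k < f i → T i j ≤ T i k
  col_strict : ∀ i k j, i < k → j < f k → T i j < T k j
  lt : ∀ i j, j < f i → T i j < N

/-- Fill the boxes of the shape `f` outside the shape `g` with the entry `N`. -/
def fillOutside (N : ℕ) (f g : ℕ → ℕ) (T : ℕ → ℕ → ℕ) (i j : ℕ) : ℕ :=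
  if j < g i then T i j else if j < f i then N else 0

/-- The shape formed by the boxes of `g` is obtained from the shape `f`, with at most `N + 1` rows,
by removing a horizontal strip. -/
structure Interlaces (N : ℕ) (f g : ℕ → ℕ) : Prop where
  anti : Antitone g
  le : ∀ i, g i ≤ f i
  ge : ∀ i, f (i + 1) ≤ g i
  eq_zero : ∀ i, N ≤ i → g i = 0

theorem interlaces_extendZero {N : ℕ} {f : ℕ → ℕ} (hf : ∀ i, N + 1 ≤ i → f i = 0) {g : Fin N → ℕ}
    (hg : ∀ i : Fin N, f (i + 1) ≤ g i ∧ g i ≤ f i) : Interlaces N f (extendZero g) := by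
  have hle (i : ℕ) : extendZero g i ≤ f i := by
    unfold extendZero
    split_ifs with h
    exacts [(hg ⟨i, h⟩).2, Nat.zero_le _]
  have hge (i : ℕ) : f (i + 1) ≤ extendZero g i := by
    unfold extendZero
    split_ifs with h
    exacts [(hg ⟨i, h⟩).1, (hf _ (by omega)).le]
  exact ⟨antitone_nat_of_succ_le fun i => (hle _).trans (hge _), hle, hge,
    fun i hi => dif_neg (by omega)⟩

theorem IsBoundedSSYT.le_entry {N : ℕ} {f : ℕ → ℕ} {T : ℕ → ℕ → ℕ} (h : IsBoundedSSYT N f T)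
    (hf : Antitone f) {i j : ℕ} (hj : j < f i) : i ≤ T i j := by
  induction i with
  | zero => exact Nat.zero_le _
  | succ i ih =>
    have h1 := ih (hj.trans_le (hf i.le_succ))
    have h2 := h.col_strict i (i + 1) j i.lt_succ_self hj
    omega

theorem IsBoundedSSYT.fillOutside {N : ℕ} {f g : ℕ → ℕ} {T : ℕ → ℕ → ℕ} (hf : Antitone f)
    (hg : Interlaces N f g) (h : IsBoundedSSYT N g T) :
    IsBoundedSSYT (N + 1) f (fillOutside N f g T) where
  eq_zero i j hj := by
    have := hg.le i
    simp only [_root_.fillOutside]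
    split_ifs <;> omega
  row_weak i j k hjk hk := by
    have h1 := h.row_weak i j k hjk
    have h2 := h.lt i j
    simp only [_root_.fillOutside]
    split_ifs <;> omega
  col_strict i k j hik hj := by
    have h1 := h.col_strict i k j hik
    have h2 := h.lt i j
    have h3 : j < g i := hj.trans_le ((hf hik).trans (hg.ge i))
    simp only [_root_.fillOutside, if_pos h3, if_pos hj]
    split_ifs
    exacts [h1 ‹_›, h2 h3]
  lt i j hj := by
    have h2 := h.lt i j
    simp only [_root_.fillOutside]
    split_ifs <;> omega

theorem lt_iff_fillOutside_lt {N : ℕ} {f g : ℕ → ℕ} {T : ℕ → ℕ → ℕ}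
    (hg : Interlaces N f g) (h : IsBoundedSSYT N g T) (i j : ℕ) :
    j < g i ↔ j < f i ∧ fillOutside N f g T i j < N := by
  have h1 := h.lt i j
  have h2 := hg.le i
  unfold fillOutside
  split_ifs with h3 h4
  · exact ⟨fun _ => ⟨by omega, h1 h3⟩, fun _ => h3⟩
  · simp [h3]
  · simp [h3, h4]

theorem exists_forall_lt_iff (n : ℕ) (p : ℕ → Prop) (hp : ∀ j k, j ≤ k → k < n → p k → p j) :
    ∃ c, ∀ j, j < c ↔ j < n ∧ p j := by
  induction n with
  | zero => exact ⟨0, by simp⟩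
  | succ n ih =>
    by_cases h : p n
    · refine ⟨n + 1, fun j => ⟨fun hj => ⟨hj, hp j n (by omega) (by omega) h⟩, And.left⟩⟩
    · obtain ⟨c, hc⟩ := ih fun j k hjk hk => hp j k hjk (by omega)
      refine ⟨c, fun j => (hc j).trans ⟨fun hj => ⟨by omega, hj.2⟩, fun hj => ⟨?_, hj.2⟩⟩⟩
      have : j ≠ n := by rintro rfl; exact h hj.2
      omega

theorem IsBoundedSSYT.exists_eq_fillOutside {N : ℕ} {f : ℕ → ℕ} {T : ℕ → ℕ → ℕ} (hf : Antitone f)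
    (h : IsBoundedSSYT (N + 1) f T) :
    ∃ g : Fin N → ℕ, (∀ i : Fin N, f (i + 1) ≤ g i ∧ g i ≤ f i) ∧
      ∃ T', IsBoundedSSYT N (extendZero g) T' ∧ _root_.fillOutside N f (extendZero g) T' = T := by
  choose g hg using fun i => exists_forall_lt_iff (f i) (fun j => T i j < N)
    fun j k hjk hk hlt => (h.row_weak i j k hjk hk).trans_lt hlt
  have hgN (i : ℕ) (hi : N ≤ i) : g i = 0 := by
    by_contra h0
    have h1 := (hg i 0).1 (Nat.pos_of_ne_zero h0)
    have h2 := h.le_entry hf h1.1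
    omega
  have hext : extendZero (fun i : Fin N => g i) = g := by
    ext i
    unfold extendZero
    split_ifs with hi
    exacts [rfl, (hgN i (by omega)).symm]
  have hle (i : ℕ) : g i ≤ f i := by
    by_contra hlt
    exact lt_irrefl _ ((hg i (f i)).1 (by omega)).1
  refine ⟨fun i => g i, fun i => ⟨?_, hle i⟩, fun i j => if j < g i then T i j else 0, ?_, ?_⟩
  · by_contra hlt
    have hlt : g i < f (i + 1) := not_le.1 hlt
    have h1 := h.col_strict i (i + 1) (g i) (by omega) hlt
    have h2 := h.lt (i + 1) (g i) hlt
    exact lt_irrefl _ ((hg i (g i)).2 ⟨hlt.trans_le (hf (Nat.le_succ _)), by omega⟩)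
  · rw [hext]
    refine ⟨fun i j hj => if_neg (by omega), fun i j k hjk hk => ?_, fun i k j hik hj => ?_,
      fun i j hj => ?_⟩
    · simp only [if_pos hk, if_pos (hjk.trans_lt hk)]
      exact h.row_weak i j k hjk (hk.trans_le (hle i))
    · have h1 := (hg k j).1 hj
      have h2 := h.col_strict i k j hik h1.1
      have h3 : j < g i := (hg i j).2 ⟨h1.1.trans_le (hf hik.le), by omega⟩
      simpa only [if_pos hj, if_pos h3] using h2
    · simpa only [if_pos hj] using ((hg i j).1 hj).2
  · rw [hext]
    ext i j
    unfold _root_.fillOutside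
    split_ifs with h1 h2
    · exact if_pos h1
    · have h3 := h.lt i j h2
      have h4 := mt (hg i j).2 h1
      have : ¬ T i j < N := fun h5 => h4 ⟨h2, h5⟩
      omega
    · exact (h.eq_zero i j (by omega)).symm

theorem alternant_succ_zero {R : Type*} [CommRing R] (N : ℕ) (x : ℕ → R) :
    alternant (N + 1) x 0 = (∏ j ∈ Finset.range N, (x j - x N)) * alternant N x 0 := by
  rw [alternant_succ N x 0 antitone_const]
  have h : (Fintype.piFinset fun i : Fin N =>
      Finset.Icc ((0 : ℕ → ℕ) (i + 1)) ((0 : ℕ → ℕ) i)) = {0} := by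
    ext g
    simp [funext_iff]
  have h0 : extendZero (0 : Fin N → ℕ) = 0 := by
    ext i
    simp [extendZero]
  rw [h, Finset.sum_singleton, h0]
  simp

open Finset in
theorem prod_fillOutside {R : Type*} [CommRing R] (x : ℕ → R) {N : ℕ} {f g : ℕ → ℕ}
    (hg : Interlaces N f g) (T : ℕ → ℕ → ℕ) :
    ∏ i ∈ range (N + 1), ∏ j ∈ range (f i), x (fillOutside N f g T i j) =
      (x N ^ f N * ∏ i ∈ range N, x N ^ (f i - g i)) *
        ∏ i ∈ range N, ∏ j ∈ range (g i), x (T i j) := by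
  have hrow (i : ℕ) : ∏ j ∈ range (f i), x (fillOutside N f g T i j) =
      x N ^ (f i - g i) * ∏ j ∈ range (g i), x (T i j) := by
    rw [← prod_range_mul_prod_Ico _ (hg.le i), mul_comm]
    congr 1
    · rw [← Nat.card_Ico, ← prod_const]
      refine prod_congr rfl fun j hj => ?_
      rw [mem_Ico] at hj
      rw [fillOutside, if_neg (by omega), if_pos hj.2]
    · refine prod_congr rfl fun j hj => ?_
      rw [fillOutside, if_pos (mem_range.1 hj)]
  simp only [hrow, prod_mul_distrib]
  rw [prod_range_succ, prod_range_succ _ N, hg.eq_zero N le_rfl]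
  simp only [range_zero, prod_empty, Nat.sub_zero]
  ring

open Finset in
theorem exists_finset_isBoundedSSYT {R : Type*} [CommRing R] (x : ℕ → R) (N : ℕ) (f : ℕ → ℕ)
    (hf : Antitone f) (hf0 : ∀ i, N ≤ i → f i = 0) :
    ∃ s : Finset (ℕ → ℕ → ℕ), (∀ T, T ∈ s ↔ IsBoundedSSYT N f T) ∧
      alternant N x 0 * ∑ T ∈ s, ∏ i ∈ range N, ∏ j ∈ range (f i), x (T i j) =
        alternant N x f := by
  classical
  induction N generalizing f with
  | zero =>
    refine ⟨{0}, fun T => ⟨fun hT => ?_, fun hT => ?_⟩, by simp [alternant]⟩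
    · rw [mem_singleton.1 hT]
      refine ⟨fun _ _ _ => rfl, fun _ _ _ _ _ => le_rfl, fun i k j _ hj => ?_, fun i j hj => ?_⟩
      all_goals
        rw [hf0 _ (Nat.zero_le _)] at hj
        omega
    · rw [mem_singleton]
      ext i j
      exact hT.eq_zero i j ((hf0 i (Nat.zero_le _)).le.trans (Nat.zero_le _))
  | succ N ih =>
    have key (g : Fin N → ℕ) (hg : g ∈ Fintype.piFinset fun i : Fin N => Icc (f (i + 1)) (f i)) :
        Interlaces N f (extendZero g) :=
      interlaces_extendZero hf0 (by simpa using hg)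
    have ih' (g : Fin N → ℕ)
        (hg : g ∈ Fintype.piFinset fun i : Fin N => Icc (f (i + 1)) (f i)) :=
      ih (extendZero g) (key g hg).anti (key g hg).eq_zero
    choose! s hs hsum using ih'
    refine ⟨(Fintype.piFinset fun i : Fin N => Icc (f (i + 1)) (f i)).biUnion fun g =>
      (s g).image (fillOutside N f (extendZero g)), fun T => ?_, ?_⟩
    · simp only [mem_biUnion, mem_image]
      constructor
      · rintro ⟨g, hg, T', hT', rfl⟩
        exact ((hs g hg T').1 hT').fillOutside hf (key g hg)
      · intro hT
        obtain ⟨g, hg, T', hT', rfl⟩ := hT.exists_eq_fillOutside hf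
        have hg' : g ∈ Fintype.piFinset fun i : Fin N => Icc (f (i + 1)) (f i) := by simpa using hg
        exact ⟨g, hg', T', (hs g hg' T').2 hT', rfl⟩
    · rw [sum_biUnion, alternant_succ_zero, alternant_succ N x f hf, mul_assoc, mul_sum]
      · congr 1
        refine sum_congr rfl fun g hg => ?_
        rw [sum_image, ← hsum g hg]
        · simp only [prod_fillOutside x (key g hg), ← mul_sum]
          rw [← Fin.prod_univ_eq_prod_range (fun i => x N ^ (f i - extendZero g i))]
          simp only [extendZero_val]
          ring
        · intro T hT T' hT' heq
          have h := (hs g hg T).1 hT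
          have h' := (hs g hg T').1 hT'
          ext i j
          by_cases hj : j < extendZero g i
          · simpa only [fillOutside, if_pos hj] using congrFun₂ heq i j
          · rw [h.eq_zero i j (by omega), h'.eq_zero i j (by omega)]
      · intro g hg g' hg' hne
        refine disjoint_left.2 fun T hT hT' => hne ?_
        obtain ⟨T₁, hT₁, rfl⟩ := mem_image.1 hT
        obtain ⟨T₂, hT₂, heq⟩ := mem_image.1 hT'
        ext i
        have h₁ := lt_iff_fillOutside_lt (key g hg) ((hs g hg T₁).1 hT₁) i
        have h₂ := lt_iff_fillOutside_lt (key g' hg') ((hs g' hg' T₂).1 hT₂) i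
        rw [heq] at h₂
        simp only [extendZero_val] at h₁ h₂
        exact eq_of_forall_lt_iff fun j => (h₁ j).trans (h₂ j).symm

open Finset in
theorem alternant_geometric {R : Type*} [CommRing R] (b : R) (N : ℕ) (f : ℕ → ℕ) :
    alternant N (fun j => b ^ j) f =
      ∏ j ∈ range N, ∏ i ∈ range j, (b ^ (f j + (N - 1 - j)) - b ^ (f i + (N - 1 - i))) := by
  rw [alternant, ← Matrix.det_submatrix_equiv_self Fin.revPerm]
  have h : (Matrix.of fun i j : Fin N => (b ^ (j.rev : ℕ)) ^ (f i.rev + i)).submatrix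
      Fin.revPerm Fin.revPerm = Matrix.vandermonde fun i : Fin N => b ^ (f i + (N - 1 - i)) := by
    ext i j
    rw [Matrix.submatrix_apply, Matrix.of_apply, Fin.revPerm_apply, Fin.revPerm_apply, Fin.rev_rev,
      Fin.rev_rev, Matrix.vandermonde_apply, ← pow_mul, ← pow_mul, Fin.val_rev, mul_comm,
      Nat.sub_sub, Nat.add_comm 1]
  rw [h, Matrix.det_vandermonde, prod_comm' (t' := univ) (s' := Iio) (by simp),
    ← Fin.prod_univ_eq_prod_range (fun j => ∏ i ∈ range j,
      (b ^ (f j + (N - 1 - j)) - b ^ (f i + (N - 1 - i))))]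
  refine prod_congr rfl fun j _ => ?_
  rw [← Nat.Iio_eq_range, ← Fin.map_valEmbedding_Iio, prod_map]
  rfl

open Finset in
theorem alternant_geometric_eq_mul {b : ℝ} (hb0 : 0 < b) (hb1 : b < 1) (N : ℕ) {f : ℕ → ℕ}
    (hf : Antitone f) :
    alternant N (fun j => b ^ j) f = alternant N (fun j => b ^ j) 0 *
      (b ^ (∑ j ∈ range N, j * f j) * ∏ j ∈ range N, ∏ i ∈ range j,
        (1 - b ^ (f i - f j + (j - i))) / (1 - b ^ (j - i))) := by
  have hpow : b ^ (∑ j ∈ range N, j * f j) = ∏ j ∈ range N, ∏ _i ∈ range j, b ^ f j := by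
    simp [← prod_pow_eq_pow_sum, ← pow_mul, mul_comm]
  simp only [hpow, alternant_geometric, ← prod_mul_distrib]
  refine prod_congr rfl fun j hj => prod_congr rfl fun i hi => ?_
  rw [mem_range] at hi hj
  have hne : 1 - b ^ (j - i) ≠ 0 := (sub_pos.2 (pow_lt_one₀ hb0.le hb1 (by omega))).ne'
  have hle := hf hi.le
  have h1 : f i + (N - 1 - i) = (f j + (N - 1 - j)) + (f i - f j + (j - i)) := by omega
  have h2 : N - 1 - i = (N - 1 - j) + (j - i) := by omega
  rw [h1, Pi.zero_apply, Pi.zero_apply, zero_add, zero_add, h2]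
  field_simp
  ring

theorem alternant_geometric_zero_ne_zero {b : ℝ} (hb0 : 0 < b) (hb1 : b < 1) (N : ℕ) :
    alternant N (fun j => b ^ j) 0 ≠ 0 := by
  simp only [alternant_geometric, Finset.prod_ne_zero_iff, Finset.mem_range]
  intro j hj i hi h
  have := pow_right_injective₀ hb0 hb1.ne (sub_eq_zero.1 h)
  simp at this
  omega

open Finset in
/-- The principal specialization of a Schur polynomial in `N` variables. -/
theorem exists_finset_sum_geometric {b : ℝ} (hb0 : 0 < b) (hb1 : b < 1) (N : ℕ) {f : ℕ → ℕ}
    (hf : Antitone f) (hf0 : ∀ i, N ≤ i → f i = 0) :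
    ∃ s : Finset (ℕ → ℕ → ℕ), (∀ T, T ∈ s ↔ IsBoundedSSYT N f T) ∧
      ∑ T ∈ s, ∏ i ∈ range N, ∏ j ∈ range (f i), b ^ T i j =
        b ^ (∑ j ∈ range N, j * f j) * ∏ j ∈ range N, ∏ i ∈ range j,
          (1 - b ^ (f i - f j + (j - i))) / (1 - b ^ (j - i)) := by
  obtain ⟨s, hs, hsum⟩ := exists_finset_isBoundedSSYT (fun j => b ^ j) N f hf hf0
  rw [alternant_geometric_eq_mul hb0 hb1 N hf] at hsum
  exact ⟨s, hs, mul_left_cancel₀ (alternant_geometric_zero_ne_zero hb0 hb1 N) hsum⟩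

theorem YoungDiagram.rowLen_eq_zero (μ : YoungDiagram) {i : ℕ} (hi : μ.colLen 0 ≤ i) :
    μ.rowLen i = 0 := by
  by_contra h
  have h1 : (i, 0) ∈ μ := YoungDiagram.mem_iff_lt_rowLen.2 (Nat.pos_of_ne_zero h)
  have h2 := YoungDiagram.mem_iff_lt_colLen.1 h1
  omega

open Finset in
theorem prod_range_add_shape {b : ℝ} (hb0 : 0 < b) (hb1 : b < 1) {f : ℕ → ℕ} {l : ℕ}
    (hf0 : ∀ i, l ≤ i → f i = 0) (M : ℕ) :
    ∏ j ∈ range (l + M), ∏ i ∈ range j, (1 - b ^ (f i - f j + (j - i))) / (1 - b ^ (j - i)) =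
      (∏ j ∈ range l, ∏ i ∈ range j, (1 - b ^ (f i - f j + (j - i))) / (1 - b ^ (j - i))) *
        ∏ i ∈ range l, ∏ m ∈ range M,
          (1 - b ^ (f i + (l + m - i))) / (1 - b ^ (l + m - i)) := by
  rw [prod_range_add, prod_comm (s := range l) (t := range M)]
  congr 1
  refine prod_congr rfl fun m _ => ?_
  rw [prod_range_add, hf0 (l + m) (by omega)]
  simp only [Nat.sub_zero]
  refine (congrArg _ (prod_eq_one fun k hk => ?_)).trans (mul_one _)
  rw [mem_range] at hk
  rw [hf0 (l + k) (by omega), zero_add]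
  exact div_self (sub_pos.2 (pow_lt_one₀ hb0.le hb1 (by omega))).ne'

theorem multipliable_one_sub_pow_div {b : ℝ} (hb0 : 0 < b) (hb1 : b < 1) (a : ℕ) {i l : ℕ}
    (hi : i < l) : Multipliable fun m : ℕ => (1 - b ^ (a + (l + m - i))) / (1 - b ^ (l + m - i)) := by
  have hpos (m : ℕ) : 1 - b ≤ 1 - b ^ (l + m - i) :=
    sub_le_sub_left (pow_le_of_le_one hb0.le hb1.le (by omega)) 1
  have hb : 0 < 1 - b := sub_pos.2 hb1
  have h : Summable fun m : ℕ =>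
      (b ^ (l + m - i) - b ^ (a + (l + m - i))) / (1 - b ^ (l + m - i)) := by
    refine Summable.of_nonneg_of_le (fun m => ?_) (fun m => ?_)
      ((summable_geometric_of_lt_one hb0.le hb1).div_const (1 - b))
    · exact div_nonneg (sub_nonneg.2 (pow_le_pow_of_le_one hb0.le hb1.le (by omega)))
        (hb.le.trans (hpos m))
    · refine div_le_div₀ (pow_nonneg hb0.le _) ?_ hb (hpos m)
      exact (sub_le_self _ (pow_nonneg hb0.le _)).trans
        (pow_le_pow_of_le_one hb0.le hb1.le (by omega))
  refine (Real.multipliable_one_add_of_summable h).congr fun m => ?_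
  have := (hb.trans_le (hpos m)).ne'
  field_simp
  ring

/-- Extension by zero of a filling of a Young diagram. -/
def extendFilling (μ : YoungDiagram) (T : μ.cells → ℕ) (i j : ℕ) : ℕ :=
  if h : (i, j) ∈ μ.cells then T ⟨(i, j), h⟩ else 0

theorem isBoundedSSYT_extendFilling {μ : YoungDiagram} {T : μ.cells → ℕ} {N : ℕ}
    (hT : IsSSYTNat μ T) (hN : ∀ c, T c < N) :
    IsBoundedSSYT N μ.rowLen (extendFilling μ T) where
  eq_zero i j hj := dif_neg fun h => by
    rw [YoungDiagram.mem_cells, YoungDiagram.mem_iff_lt_rowLen] at h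
    omega
  row_weak i j k hjk hk := by
    have h1 : (i, k) ∈ μ.cells := YoungDiagram.mem_iff_lt_rowLen.2 hk
    have h2 : (i, j) ∈ μ.cells := YoungDiagram.mem_iff_lt_rowLen.2 (hjk.trans_lt hk)
    rw [extendFilling, extendFilling, dif_pos h1, dif_pos h2]
    exact hT.1 _ _ rfl hjk
  col_strict i k j hik hj := by
    have h1 : (k, j) ∈ μ.cells := YoungDiagram.mem_iff_lt_rowLen.2 hj
    have h2 : (i, j) ∈ μ.cells := μ.up_left_mem hik.le le_rfl h1
    rw [extendFilling, extendFilling, dif_pos h1, dif_pos h2]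
    exact hT.2 _ _ rfl hik
  lt i j hj := by
    have h1 : (i, j) ∈ μ.cells := YoungDiagram.mem_iff_lt_rowLen.2 hj
    rw [extendFilling, dif_pos h1]
    exact hN _

theorem IsBoundedSSYT.isSSYTNat {μ : YoungDiagram} {N : ℕ} {T : ℕ → ℕ → ℕ}
    (h : IsBoundedSSYT N μ.rowLen T) :
    IsSSYTNat μ fun c => T (c : ℕ × ℕ).1 (c : ℕ × ℕ).2 := by
  refine ⟨?_, ?_⟩
  · rintro ⟨⟨i, j⟩, hc⟩ ⟨⟨i', k⟩, hc'⟩ rfl hjk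
    exact h.row_weak i j k hjk (YoungDiagram.mem_iff_lt_rowLen.1 hc')
  · rintro ⟨⟨i, j⟩, hc⟩ ⟨⟨k, j'⟩, hc'⟩ rfl hik
    exact h.col_strict i k j hik (YoungDiagram.mem_iff_lt_rowLen.1 hc')

open Finset in
theorem pow_sum_eq_prod_extendFilling (b : ℝ) {μ : YoungDiagram} (T : μ.cells → ℕ) {N : ℕ}
    (hN : μ.colLen 0 ≤ N) :
    b ^ (∑ c, T c) =
      ∏ i ∈ range N, ∏ j ∈ range (μ.rowLen i), b ^ extendFilling μ T i j := by
  rw [← prod_finset_product' μ.cells (range N) (fun i => range (μ.rowLen i)), ← prod_coe_sort,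
    ← prod_pow_eq_pow_sum]
  · exact prod_congr rfl fun c _ => by rw [extendFilling, dif_pos c.2]
  · rintro ⟨i, j⟩
    simp only [YoungDiagram.mem_cells, mem_range, YoungDiagram.mem_iff_lt_rowLen]
    refine ⟨fun h => ⟨?_, h⟩, And.right⟩
    by_contra hi
    rw [μ.rowLen_eq_zero (by omega)] at h
    omega

open Finset in
theorem exists_finset_sum_isSSYTNat {b : ℝ} (hb0 : 0 < b) (hb1 : b < 1) (μ : YoungDiagram)
    (M : ℕ) :
    ∃ s : Finset { T : μ.cells → ℕ // IsSSYTNat μ T },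
      (∀ T, T ∈ s ↔ ∀ c, T.1 c < μ.colLen 0 + M) ∧
      ∑ T ∈ s, b ^ (∑ c, T.1 c) =
        b ^ (∑ i ∈ range (μ.colLen 0), i * μ.rowLen i) *
          (∏ j ∈ range (μ.colLen 0), ∏ i ∈ range j,
            (1 - b ^ (μ.rowLen i - μ.rowLen j + (j - i))) / (1 - b ^ (j - i))) *
          ∏ i ∈ range (μ.colLen 0), ∏ m ∈ range M,
            (1 - b ^ (μ.rowLen i + (μ.colLen 0 + m - i))) /
              (1 - b ^ (μ.colLen 0 + m - i)) := by
  classical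
  set N := μ.colLen 0 + M with hN
  have hf0 (i : ℕ) (hi : μ.colLen 0 ≤ i) : μ.rowLen i = 0 := μ.rowLen_eq_zero hi
  obtain ⟨s, hs, hsum⟩ := exists_finset_sum_geometric hb0 hb1 N (f := μ.rowLen)
    (fun i j hij => μ.rowLen_anti i j hij) fun i hi => hf0 i (by omega)
  have hmem (T : { T : μ.cells → ℕ // IsSSYTNat μ T }) :
      T ∈ (Fintype.piFinset fun _ => range N).subtype (IsSSYTNat μ) ↔ ∀ c, T.1 c < N := by
    simp
  refine ⟨(Fintype.piFinset fun _ => range N).subtype (IsSSYTNat μ), hmem, ?_⟩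
  have hexp : ∑ j ∈ range N, j * μ.rowLen j = ∑ j ∈ range (μ.colLen 0), j * μ.rowLen j := by
    rw [hN, sum_range_add]
    simp [hf0]
  rw [hexp, hN, prod_range_add_shape hb0 hb1 hf0, ← mul_assoc] at hsum
  rw [← hsum]
  refine sum_bij' (fun T _ => extendFilling μ T.1)
    (fun T hT => ⟨fun c => T (c : ℕ × ℕ).1 (c : ℕ × ℕ).2, ((hs T).1 hT).isSSYTNat⟩) ?_ ?_ ?_ ?_ ?_
  · intro T hT
    exact (hs _).2 (isBoundedSSYT_extendFilling T.2 ((hmem T).1 hT))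
  · intro T hT
    exact (hmem _).2 fun c => ((hs T).1 hT).lt _ _ (YoungDiagram.mem_iff_lt_rowLen.1 c.2)
  · intro T hT
    ext c
    exact dif_pos c.2
  · intro T hT
    ext i j
    rw [extendFilling]
    split_ifs with h
    · rfl
    · refine (((hs T).1 hT).eq_zero i j ?_).symm
      rw [YoungDiagram.mem_cells, YoungDiagram.mem_iff_lt_rowLen] at h
      omega
  · intro T hT
    exact pow_sum_eq_prod_extendFilling b T.1 (by omega)

open Finset Filter in
theorem hasSum_of_tendsto_sum_of_cover {ι : Type*} {f : ι → ℝ} (hf : 0 ≤ f) {s : ℕ → Finset ι}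
    (hmono : Monotone s) (hcover : ∀ i, ∃ n, i ∈ s n) {a : ℝ}
    (h : Tendsto (fun n => ∑ i ∈ s n, f i) atTop (nhds a)) : HasSum f a := by
  have hs : Tendsto s atTop atTop := tendsto_atTop_finset_of_monotone hmono hcover
  have hle (n : ℕ) : ∑ i ∈ s n, f i ≤ a :=
    Monotone.ge_of_tendsto (fun m n hmn => sum_le_sum_of_subset_of_nonneg (hmono hmn)
      fun i _ _ => hf i) h n
  have hsum : Summable f := summable_of_sum_le hf (c := a) fun u => by
    obtain ⟨n, hn⟩ := (hs.eventually_ge_atTop u).exists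
    exact (sum_le_sum_of_subset_of_nonneg hn fun i _ _ => hf i).trans (hle n)
  have := tendsto_nhds_unique (hsum.hasSum.comp hs) h
  exact this ▸ hsum.hasSum

/-- Evaluation of the Schur function `s_λ` at `(1, b, b², …)` for `0 < b < 1`: the
family `(b^{e(T)})`, indexed by all SSYT `T` of shape `λ` with entries in `{1, 2, 3, …}`
(no upper bound on the entries), is summable, the infinite products
`∏_{j=ℓ+1}^{∞} (1 − b^{λ_i + j − i})/(1 − b^{j − i})` (for `1 ≤ i ≤ ℓ = ℓ(λ)`) converge,
and `Σ_T b^{e(T)} = b^{n(λ)} ∏_{1 ≤ i < j ≤ ℓ} (1 − b^{λ_i − λ_j + j − i})/(1 − b^{j − i})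
· ∏_{i=1}^{ℓ} ∏_{j=ℓ+1}^{∞} (1 − b^{λ_i + j − i})/(1 − b^{j − i})`, where
`e(T) = Σ_c (T(c) − 1)`, `n(λ) = Σ_{i≥1} (i−1)λ_i`, `λ_{i+1} = μ.rowLen i` and
`ℓ = μ.colLen 0`. (The inner infinite product for the (0-indexed) row `i` is indexed by
`m : ℕ` with `j = ℓ + 1 + m` in 1-indexed terms, so `j − i = ℓ + m − i`.) -/
theorem schur_function_geometric (μ : YoungDiagram) (b : ℝ) (hb0 : 0 < b) (hb1 : b < 1) :
    Summable (fun T : { T : ↥μ.cells → ℕ // IsSSYTNat μ T } =>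
      b ^ (∑ c : ↥μ.cells, T.1 c)) ∧
    (∀ i ∈ Finset.range (μ.colLen 0),
      Multipliable (fun m : ℕ =>
        (1 - b ^ (μ.rowLen i + (μ.colLen 0 + m - i))) / (1 - b ^ (μ.colLen 0 + m - i)))) ∧
    ∑' T : { T : ↥μ.cells → ℕ // IsSSYTNat μ T }, b ^ (∑ c : ↥μ.cells, T.1 c) =
      b ^ (∑ i ∈ Finset.range (μ.colLen 0), i * μ.rowLen i) *
        (∏ j ∈ Finset.range (μ.colLen 0), ∏ i ∈ Finset.range j,
          (1 - b ^ (μ.rowLen i - μ.rowLen j + (j - i))) / (1 - b ^ (j - i))) *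
        ∏ i ∈ Finset.range (μ.colLen 0),
          ∏' m : ℕ,
            (1 - b ^ (μ.rowLen i + (μ.colLen 0 + m - i))) /
              (1 - b ^ (μ.colLen 0 + m - i)) := by
  have hmult (i : ℕ) (hi : i ∈ Finset.range (μ.colLen 0)) :=
    multipliable_one_sub_pow_div hb0 hb1 (μ.rowLen i) (Finset.mem_range.1 hi)
  choose s hs hsum using exists_finset_sum_isSSYTNat hb0 hb1 μ
  have key := hasSum_of_tendsto_sum_of_cover
    (f := fun T : { T : ↥μ.cells → ℕ // IsSSYTNat μ T } => b ^ (∑ c : ↥μ.cells, T.1 c))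
    (fun T => pow_nonneg hb0.le _) (s := s)
    (fun M M' hM T hT => (hs M' T).2 fun c => ((hs M T).1 hT c).trans_le (by omega))
    (fun T => ⟨(∑ c, T.1 c) + 1, (hs _ T).2 fun c => by
      have := Finset.single_le_sum (f := T.1) (fun _ _ => Nat.zero_le _) (Finset.mem_univ c)
      omega⟩)
    (by
      simp only [hsum]
      exact (tendsto_finsetProd _ fun i hi =>
        (hmult i hi).tendsto_prod_tprod_nat).const_mul _)
  exact ⟨key.summable, hmult, key.tsum_eq⟩
end
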